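/- Encoding reflects subtyping (completeness direction of the subtyping theorem): for all session-π types T and T', if ⟦T⟧ ≤ ⟦T'⟧ in the subtyping relation of the standard linear π-calculus, then T <: T' in the session subtyping relation. -/

import Mathlib

/-! Session types and standard linear π-types, duality, encoding. -/

namespace SessionPi

mutual
/-- Session types: `end`, `!T.S`, `?T.S`, select `⊕{lᵢ : Sᵢ}_{i∈I}`, branch `&{lᵢ : Sᵢ}_{i∈I}`.
Labels are natural numbers; the index set `I` is a finite set of labels. -/
inductive SType : Type
  | done : SType                                   -- end
  | send : Ty → SType → SType                      -- !T.S
  | recv : Ty → SType → SType                      -- ?T.S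
  | sel  : (I : Finset ℕ) → (∀ i ∈ I, SType) → SType  -- ⊕{lᵢ : Sᵢ}
  | bra  : (I : Finset ℕ) → (∀ i ∈ I, SType) → SType  -- &{lᵢ : Sᵢ}

/-- Types: session types, standard channel types `#T`, `Unit`. -/
inductive Ty : Type
  | session : SType → Ty
  | chan : Ty → Ty
  | unit : Ty
end

/-- Duality on session types. -/
def dual : SType → SType
  | .done => .done
  | .send T S => .recv T (dual S)
  | .recv T S => .send T (dual S)
  | .sel I f => .bra I (fun i h => dual (f i h))
  | .bra I f => .sel I (fun i h => dual (f i h))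

/-- Linear π-types: `ℓo[t̄]`, `ℓi[t̄]`, `∅[]`, variants, connections `#[t̄]`, `Unit`. -/
inductive PiTy : Type
  | lout : (n : ℕ) → (Fin n → PiTy) → PiTy           -- ℓo[t₁,…,tₙ]
  | lin  : (n : ℕ) → (Fin n → PiTy) → PiTy           -- ℓi[t₁,…,tₙ]
  | noCap : PiTy                                      -- ∅[]
  | variant : (I : Finset ℕ) → (∀ i ∈ I, PiTy) → PiTy -- ⟨lᵢ : tᵢ⟩
  | conn : (n : ℕ) → (Fin n → PiTy) → PiTy            -- #[t₁,…,tₙ]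
  | unit : PiTy

/-- The (partial) involution `overline` swapping the outermost input/output capability. -/
def flipCap : PiTy → PiTy
  | .lin n ts => .lout n ts
  | .lout n ts => .lin n ts
  | t => t

mutual
/-- Encoding of session types into linear π-types:
`⟦end⟧ = ∅[]`, `⟦!T.S⟧ = ℓo[⟦T⟧,⟦dual S⟧]`, `⟦?T.S⟧ = ℓi[⟦T⟧,⟦S⟧]`,
`⟦⊕{lᵢ:Sᵢ}⟧ = ℓo[⟨lᵢ:⟦dual Sᵢ⟧⟩]`, `⟦&{lᵢ:Sᵢ}⟧ = ℓi[⟨lᵢ:⟦Sᵢ⟧⟩]`.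
(`encDS` implements `S ↦ ⟦dual S⟧`; see `encDS_eq` below.) -/
def encS : SType → PiTy
  | .done => .noCap
  | .send T S => .lout 2 ![encTy T, encDS S]
  | .recv T S => .lin 2 ![encTy T, encS S]
  | .sel I f => .lout 1 ![.variant I (fun i h => encDS (f i h))]
  | .bra I f => .lin 1 ![.variant I (fun i h => encS (f i h))]

/-- `encDS S = encS (dual S)` (proved below in `encDS_eq`). -/
def encDS : SType → PiTy
  | .done => .noCap
  | .send T S => .lin 2 ![encTy T, encDS S]
  | .recv T S => .lout 2 ![encTy T, encS S]
  | .sel I f => .lin 1 ![.variant I (fun i h => encDS (f i h))]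
  | .bra I f => .lout 1 ![.variant I (fun i h => encS (f i h))]

/-- Encoding of types, homomorphic on non-session constructs. -/
def encTy : Ty → PiTy
  | .session S => encS S
  | .chan T => .conn 1 ![encTy T]
  | .unit => .unit
end

theorem encDS_eq : ∀ S : SType, encDS S = encS (dual S) ∧ encDS (dual S) = encS S := by
  intro S
  induction S using SType.rec (motive_2 := fun _ => True) with
  | done => simp [encDS, encS, dual]
  | send T S ihT ihS =>
      constructor <;> (simp only [encDS, encS, dual]; rw [ihS.1])
  | recv T S ihT ihS =>
      constructor <;> (simp only [encDS, encS, dual]; rw [ihS.2])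
  | sel I f ih =>
      have h1 : (fun i h => encDS (f i h)) = (fun i h => encS (dual (f i h))) := by
        funext i h; exact (ih i h).1
      constructor <;> (simp only [encDS, encS, dual]; rw [h1])
  | bra I f ih =>
      have h2 : (fun i h => encDS (dual (f i h))) = (fun i h => encS (f i h)) := by
        funext i h; exact (ih i h).2
      constructor <;> (simp only [encDS, encS, dual]; rw [h2])
  | session S ih => trivial
  | chan T ih => trivial
  | unit => trivial

mutual
/-- Session subtyping `<:` (branch covariant in breadth and depth;
select contravariant in breadth, covariant in depth; output contravariant
in the payload; channel types invariant). -/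
inductive SessSub : SType → SType → Prop
  | done : SessSub .done .done
  | send : ∀ {T T' : Ty} {S S' : SType},
      TySub T' T → SessSub S S' → SessSub (.send T S) (.send T' S')
  | recv : ∀ {T T' : Ty} {S S' : SType},
      TySub T T' → SessSub S S' → SessSub (.recv T S) (.recv T' S')
  | bra : ∀ {I J : Finset ℕ} {f : ∀ i ∈ I, SType} {g : ∀ j ∈ J, SType}
      (hIJ : I ⊆ J), (∀ i (h : i ∈ I), SessSub (f i h) (g i (hIJ h))) →
      SessSub (.bra I f) (.bra J g)
  | sel : ∀ {I J : Finset ℕ} {f : ∀ i ∈ I, SType} {g : ∀ j ∈ J, SType}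
      (hJI : J ⊆ I), (∀ j (h : j ∈ J), SessSub (f j (hJI h)) (g j h)) →
      SessSub (.sel I f) (.sel J g)

/-- Subtyping on session-π types. -/
inductive TySub : Ty → Ty → Prop
  | session : ∀ {S S' : SType}, SessSub S S' → TySub (.session S) (.session S')
  | chan : ∀ {T T' : Ty}, TySub T T' → TySub T' T → TySub (.chan T) (.chan T')
  | unit : TySub .unit .unit
end

/-- Subtyping `≤` on standard linear π-types (linear input covariant, linear
output contravariant, variants covariant in breadth and depth, connections
invariant). -/
inductive PiSub : PiTy → PiTy → Prop
  | noCap : PiSub .noCap .noCap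
  | lin : ∀ {n : ℕ} {ts ts' : Fin n → PiTy},
      (∀ i, PiSub (ts i) (ts' i)) → PiSub (.lin n ts) (.lin n ts')
  | lout : ∀ {n : ℕ} {ts ts' : Fin n → PiTy},
      (∀ i, PiSub (ts' i) (ts i)) → PiSub (.lout n ts) (.lout n ts')
  | variant : ∀ {I J : Finset ℕ} {ts : ∀ i ∈ I, PiTy} {ts' : ∀ j ∈ J, PiTy}
      (hIJ : I ⊆ J), (∀ i (h : i ∈ I), PiSub (ts i h) (ts' i (hIJ h))) →
      PiSub (.variant I ts) (.variant J ts')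
  | conn : ∀ {n : ℕ} {ts : Fin n → PiTy}, PiSub (.conn n ts) (.conn n ts)
  | unit : PiSub .unit .unit

theorem PiSub.refl (t : PiTy) : PiSub t t := by
  induction t with
  | lout n ts ih => exact .lout ih
  | lin n ts ih => exact .lin ih
  | noCap => exact .noCap
  | variant I ts ih => exact .variant (Finset.Subset.refl I) ih
  | conn n ts ih => exact .conn
  | unit => exact .unit

theorem piSub_lin_iff {n : ℕ} {ts ts' : Fin n → PiTy} :
    PiSub (.lin n ts) (.lin n ts') ↔ ∀ i, PiSub (ts i) (ts' i) :=
  ⟨fun h => by cases h; assumption, .lin⟩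

theorem piSub_lout_iff {n : ℕ} {ts ts' : Fin n → PiTy} :
    PiSub (.lout n ts) (.lout n ts') ↔ ∀ i, PiSub (ts' i) (ts i) :=
  ⟨fun h => by cases h; assumption, .lout⟩

theorem piSub_variant_iff {I J : Finset ℕ} {ts : ∀ i ∈ I, PiTy} {ts' : ∀ j ∈ J, PiTy} :
    PiSub (.variant I ts) (.variant J ts') ↔
      ∃ hIJ : I ⊆ J, ∀ i (h : i ∈ I), PiSub (ts i h) (ts' i (hIJ h)) :=
  ⟨fun h => by cases h with | variant hIJ h => exact ⟨hIJ, h⟩, fun ⟨hIJ, h⟩ => .variant hIJ h⟩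

theorem eq_of_piSub_conn {n : ℕ} {ts ts' : Fin n → PiTy}
    (h : PiSub (.conn n ts) (.conn n ts')) : ts = ts' := by
  cases h; rfl

/-- `S` reflects subtyping, as either side of a comparison, through both the encoding and the
encoding of its dual. -/
def ReflectsSess (S : SType) : Prop :=
  ∀ S' : SType,
    (PiSub (encS S) (encS S') → SessSub S S') ∧ (PiSub (encS S') (encS S) → SessSub S' S) ∧
    (PiSub (encDS S) (encDS S') → SessSub S' S) ∧ (PiSub (encDS S') (encDS S) → SessSub S S')

/-- `T` reflects subtyping, as either side of a comparison. -/
def ReflectsTy (T : Ty) : Prop :=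
  ∀ T' : Ty,
    (PiSub (encTy T) (encTy T') → TySub T T') ∧ (PiSub (encTy T') (encTy T) → TySub T' T)

theorem reflectsSess_done : ReflectsSess .done := by
  intro S'
  cases S' <;> simp only [encS, encDS] <;> refine ⟨?_, ?_, ?_, ?_⟩ <;> intro h <;>
    first | exact .done | nomatch h

theorem reflectsSess_send {T : Ty} {S : SType} (hT : ReflectsTy T) (hS : ReflectsSess S) :
    ReflectsSess (.send T S) := by
  intro S'
  cases S' with
  | send T' S' =>
    simp only [encS, encDS, piSub_lin_iff, piSub_lout_iff, Fin.forall_fin_two,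
      Matrix.cons_val_zero, Matrix.cons_val_one]
    obtain ⟨hT₁, hT₂⟩ := hT T'
    obtain ⟨-, -, hS₁, hS₂⟩ := hS S'
    exact ⟨fun h => .send (hT₂ h.1) (hS₂ h.2), fun h => .send (hT₁ h.1) (hS₁ h.2),
      fun h => .send (hT₁ h.1) (hS₁ h.2), fun h => .send (hT₂ h.1) (hS₂ h.2)⟩
  | _ => simp only [encS, encDS]; refine ⟨?_, ?_, ?_, ?_⟩ <;> intro h <;> nomatch h

theorem reflectsSess_recv {T : Ty} {S : SType} (hT : ReflectsTy T) (hS : ReflectsSess S) :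
    ReflectsSess (.recv T S) := by
  intro S'
  cases S' with
  | recv T' S' =>
    simp only [encS, encDS, piSub_lin_iff, piSub_lout_iff, Fin.forall_fin_two,
      Matrix.cons_val_zero, Matrix.cons_val_one]
    obtain ⟨hT₁, hT₂⟩ := hT T'
    obtain ⟨hS₁, hS₂, -, -⟩ := hS S'
    exact ⟨fun h => .recv (hT₁ h.1) (hS₁ h.2), fun h => .recv (hT₂ h.1) (hS₂ h.2),
      fun h => .recv (hT₂ h.1) (hS₂ h.2), fun h => .recv (hT₁ h.1) (hS₁ h.2)⟩
  | _ => simp only [encS, encDS]; refine ⟨?_, ?_, ?_, ?_⟩ <;> intro h <;> nomatch h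

theorem reflectsSess_sel {I : Finset ℕ} {f : ∀ i ∈ I, SType}
    (hf : ∀ i (h : i ∈ I), ReflectsSess (f i h)) : ReflectsSess (.sel I f) := by
  intro S'
  cases S' with
  | sel J g =>
    simp only [encS, encDS, piSub_lin_iff, piSub_lout_iff, Fin.forall_fin_one,
      Matrix.cons_val_zero, piSub_variant_iff]
    have h₁ : (∃ hIJ : I ⊆ J, ∀ i (h : i ∈ I), PiSub (encDS (f i h)) (encDS (g i (hIJ h)))) →
        SessSub (.sel J g) (.sel I f) :=
      fun ⟨hIJ, h⟩ => .sel hIJ fun i hi => (hf i hi _).2.2.1 (h i hi)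
    have h₂ : (∃ hJI : J ⊆ I, ∀ j (h : j ∈ J), PiSub (encDS (g j h)) (encDS (f j (hJI h)))) →
        SessSub (.sel I f) (.sel J g) :=
      fun ⟨hJI, h⟩ => .sel hJI fun j hj => (hf j (hJI hj) _).2.2.2 (h j hj)
    exact ⟨h₂, h₁, h₁, h₂⟩
  | _ => simp only [encS, encDS]; refine ⟨?_, ?_, ?_, ?_⟩ <;> intro h <;> nomatch h

theorem reflectsSess_bra {I : Finset ℕ} {f : ∀ i ∈ I, SType}
    (hf : ∀ i (h : i ∈ I), ReflectsSess (f i h)) : ReflectsSess (.bra I f) := by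
  intro S'
  cases S' with
  | bra J g =>
    simp only [encS, encDS, piSub_lin_iff, piSub_lout_iff, Fin.forall_fin_one,
      Matrix.cons_val_zero, piSub_variant_iff]
    have h₁ : (∃ hIJ : I ⊆ J, ∀ i (h : i ∈ I), PiSub (encS (f i h)) (encS (g i (hIJ h)))) →
        SessSub (.bra I f) (.bra J g) :=
      fun ⟨hIJ, h⟩ => .bra hIJ fun i hi => (hf i hi _).1 (h i hi)
    have h₂ : (∃ hJI : J ⊆ I, ∀ j (h : j ∈ J), PiSub (encS (g j h)) (encS (f j (hJI h)))) →
        SessSub (.bra J g) (.bra I f) :=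
      fun ⟨hJI, h⟩ => .bra hJI fun j hj => (hf j (hJI hj) _).2.1 (h j hj)
    exact ⟨h₁, h₂, h₂, h₁⟩
  | _ => simp only [encS, encDS]; refine ⟨?_, ?_, ?_, ?_⟩ <;> intro h <;> nomatch h

theorem reflectsTy_session {S : SType} (hS : ReflectsSess S) : ReflectsTy (.session S) := by
  intro T'
  cases T' with
  | session S' =>
    simp only [encTy]
    exact ⟨fun h => .session ((hS S').1 h), fun h => .session ((hS S').2.1 h)⟩
  | _ =>
    cases S <;> simp only [encTy, encS] <;> refine ⟨?_, ?_⟩ <;> intro h <;> nomatch h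

theorem reflectsTy_chan {T : Ty} (hT : ReflectsTy T) : ReflectsTy (.chan T) := by
  intro T'
  cases T' with
  | chan T' =>
    have key : encTy T = encTy T' → TySub T T' ∧ TySub T' T := fun h =>
      ⟨(hT T').1 (h ▸ PiSub.refl _), (hT T').2 (h ▸ PiSub.refl _)⟩
    simp only [encTy]
    refine ⟨fun h => ?_, fun h => ?_⟩
    · obtain ⟨h₁, h₂⟩ := key (congrFun (eq_of_piSub_conn h) 0)
      exact .chan h₁ h₂
    · obtain ⟨h₁, h₂⟩ := key (congrFun (eq_of_piSub_conn h) 0).symm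
      exact .chan h₂ h₁
  | session S =>
    cases S <;> simp only [encTy, encS] <;> refine ⟨?_, ?_⟩ <;> intro h <;> nomatch h
  | unit => simp only [encTy]; refine ⟨?_, ?_⟩ <;> intro h <;> nomatch h

theorem reflectsTy_unit : ReflectsTy .unit := by
  intro T'
  cases T' with
  | unit => exact ⟨fun _ => .unit, fun _ => .unit⟩
  | session S =>
    cases S <;> simp only [encTy, encS] <;> refine ⟨?_, ?_⟩ <;> intro h <;> nomatch h
  | chan T => simp only [encTy]; refine ⟨?_, ?_⟩ <;> intro h <;> nomatch h

theorem reflectsTy (T : Ty) : ReflectsTy T :=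
  Ty.rec (motive_1 := ReflectsSess) (motive_2 := ReflectsTy) reflectsSess_done
    (fun _ _ => reflectsSess_send) (fun _ _ => reflectsSess_recv)
    (fun _ _ => reflectsSess_sel) (fun _ _ => reflectsSess_bra)
    (fun _ => reflectsTy_session) (fun _ => reflectsTy_chan) reflectsTy_unit T

/-- The encoding reflects subtyping: if `⟦T⟧ ≤ ⟦T'⟧` in the subtyping relation
of the linear π-calculus, then `T <: T'` in the session subtyping relation. -/
theorem enc_reflects_subtyping (T T' : Ty) (h : PiSub (encTy T) (encTy T')) :
    TySub T T' :=
  (reflectsTy T T').1 h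

end SessionPi
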